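/- Let k \ge 1 and, for each t = 1, ..., k, let B_t(x,y) = 1 + \sum_{u=1}^{k_t} \sum_{v=p_t}^{q_t} B^{(t)}_{u,v} x^u y^v, where k_t \ge 1 and 1 \le p_t \le q_t, be a real bivariate polynomial with all coefficients B^{(t)}_{u,v} \ge 0. Let \delta_1, ..., \delta_k > 0 be rational and let \alpha, \beta > 0 be rational. Suppose x_0 > 0 and y_0 > 0 are positive real numbers satisfying the pair of simultaneous equations x_0 \sum_{t=1}^{k} \delta_t (\partial B_t/\partial x)(x_0,y_0)/B_t(x_0,y_0) = \alpha and y_0 \sum_{t=1}^{k} \delta_t (\partial B_t/\partial y)(x_0,y_0)/B_t(x_0,y_0) = \beta. Then the limit, taken over positive integers n for which \delta_t n (for all t), \alpha n and \beta n are integers and the coefficient of x^{\alpha n} y^{\beta n} in \prod_{t=1}^{k} (B_t(x,y))^{\delta_t n} is positive, satisfies lim_{n \to \infty} (1/n) \log Coeff[ \prod_{t=1}^{k} (B_t(x,y))^{\delta_t n}, x^{\alpha n} y^{\beta n} ] = \sum_{t=1}^{k} \delta_t \log B_t(x_0,y_0) - \alpha \log x_0 - \beta \log y_0, where Coeff[p(x,y),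 x^c y^d] denotes the coefficient of x^c y^d in the bivariate polynomial p(x,y). -/

import Mathlib

/-- The bivariate polynomial `B(x,y) = 1 + ∑_{u=1}^{k} ∑_{v=p}^{q} B_{u,v} x^u y^v`,
where variable `0` plays the role of `x` and variable `1` the role of `y`. -/
noncomputable def polyB (k p q : ℕ) (B : ℕ → ℕ → ℝ) : MvPolynomial (Fin 2) ℝ :=
  1 + ∑ u ∈ Finset.Icc 1 k, ∑ v ∈ Finset.Icc p q,
    MvPolynomial.C (B u v) * MvPolynomial.X (0 : Fin 2) ^ u *
      MvPolynomial.X (1 : Fin 2) ^ v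

section Aux
open Finset
lemma lat {I κ : Type} [Fintype I] (A : κ → I → ℤ) : ∃ C : ℝ, ∀ v : I → ℝ,
    (∀ k, ∑ i, (A k i : ℝ) * v i = 0) → ∃ z : I → ℤ, (∀ k, ∑ i, A k i * z i = 0) ∧
      ∀ i, |v i - z i| ≤ C := by
  classical
  let K : Submodule ℤ (I → ℤ) :=
    { carrier := {z | ∀ k, ∑ i, A k i * z i = 0}
      add_mem' := by
        intro a b ha hb k
        simp only [Pi.add_apply, mul_add, sum_add_distrib]
        rw [ha k, hb k, add_zero]
      zero_mem' := by intro k; simp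
      smul_mem' := by
        intro c a ha k
        have := ha k
        simp only [Pi.smul_apply, smul_eq_mul, mul_left_comm _ c, ← mul_sum]
        rw [this, mul_zero] }
  have hK : ∀ z, z ∈ K ↔ ∀ k, ∑ i, A k i * z i = 0 := fun z => Iff.rfl
  obtain ⟨d, b, hb⟩ := Submodule.fg_iff_exists_fin_generating_family.1
    (IsNoetherian.noetherian K)
  have hbK : ∀ l, b l ∈ K := fun l => hb ▸ Submodule.subset_span ⟨l, rfl⟩
  refine ⟨∑ i, ∑ l, |(b l i : ℝ)|, fun v hv => ?_⟩
  -- expand v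
  have key : ∃ a : Fin d → ℝ, ∀ i, v i = ∑ l, a l * (b l i : ℝ) := by
    let W := Submodule.span ℤ (Set.range v)
    have : Module.Finite ℤ W := Module.Finite.span_of_finite ℤ (Set.finite_range v)
    have : Module.Free ℤ W := inferInstance
    let r := Module.Free.chooseBasis ℤ W
    let vi : I → W := fun i => ⟨v i, Submodule.subset_span ⟨i, rfl⟩⟩
    let c : Module.Free.ChooseBasisIndex ℤ W → I → ℤ := fun j i => r.repr (vi i) j
    have hc : ∀ j, c j ∈ K := by
      intro j
      rw [hK]
      intro k
      have h0 : ∑ i, A k i • vi i = 0 := by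
        apply Subtype.ext
        simp only [AddSubmonoidClass.coe_finsetSum, Submodule.coe_smul, Submodule.coe_zero, vi, zsmul_eq_mul]
        exact hv k
      have := congrArg (fun w => r.repr w j) h0
      simpa [c] using this
    have hce : ∀ j, ∃ e : Fin d → ℤ, ∑ l, e l • b l = c j := by
      intro j
      have := hc j
      rw [← hb] at this
      exact (Submodule.mem_span_range_iff_exists_fun ℤ).1 this
    choose e he using hce
    refine ⟨fun l => ∑ j, (e j l : ℝ) * (r j : ℝ), fun i => ?_⟩
    have h1 : v i = ∑ j, (c j i : ℝ) * (r j : ℝ) := by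
      have := congrArg (Subtype.val) (r.sum_repr (vi i))
      simp only [AddSubmonoidClass.coe_finsetSum, Submodule.coe_smul, zsmul_eq_mul] at this
      exact this.symm
    rw [h1]
    simp_rw [sum_mul]
    rw [sum_comm]
    refine sum_congr rfl fun j _ => ?_
    rw [← he j]
    simp only [Finset.sum_apply, Pi.smul_apply, smul_eq_mul, Int.cast_sum, Int.cast_mul, sum_mul]
    refine sum_congr rfl fun l _ => ?_
    ring
  obtain ⟨a, ha⟩ := key
  refine ⟨∑ l, ⌊a l⌋ • b l, ?_, fun i => ?_⟩
  · rw [← hK]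
    exact K.sum_mem fun l _ => K.smul_mem _ (hbK l)
  · rw [ha]
    simp only [Finset.sum_apply, Pi.smul_apply, smul_eq_mul, Int.cast_sum, Int.cast_mul]
    rw [← sum_sub_distrib]
    calc _ ≤ ∑ l, |a l * (b l i : ℝ) - ⌊a l⌋ * (b l i : ℝ)| := abs_sum_le_sum_abs _ _
      _ ≤ ∑ l, |(b l i : ℝ)| := by
        refine sum_le_sum fun l _ => ?_
        rw [← sub_mul, abs_mul]
        refine mul_le_of_le_one_left (abs_nonneg _) ?_
        rw [abs_le]
        constructor
        · linarith [Int.floor_le (a l)]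
        · linarith [Int.lt_floor_add_one (a l)]
      _ ≤ _ := single_le_sum (f := fun i => ∑ l, |(b l i : ℝ)|) (fun i _ => sum_nonneg fun l _ => abs_nonneg _) (mem_univ i)

lemma fact_lo (m : ℕ) : (m:ℝ) * Real.log m - m ≤ Real.log (m.factorial) := by
  induction m with
  | zero => simp
  | succ m ih =>
    rw [Nat.factorial_succ]
    push_cast
    rw [Real.log_mul (by positivity) (by positivity)]
    rcases Nat.eq_zero_or_pos m with rfl | hm
    · simp
    have hm' : (0:ℝ) < m := by exact_mod_cast hm
    have h := Real.log_le_sub_one_of_pos (show (0:ℝ) < (m+1)/m by positivity)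
    rw [Real.log_div (by positivity) (by positivity)] at h
    have h2 : ((m:ℝ)+1)/m - 1 = 1/m := by field_simp; ring
    rw [h2] at h
    have h3 := mul_le_mul_of_nonneg_left h hm'.le
    rw [mul_one_div_cancel hm'.ne'] at h3
    nlinarith

lemma fact_hi (m : ℕ) : Real.log (m.factorial) ≤ (m:ℝ) * Real.log m - m + 1 + Real.log (m+1) := by
  have : Real.log (m.factorial) + m ≤ (m+1) * Real.log (m+1) + 0 := by
    induction m with
    | zero => simp
    | succ m ih =>
      rw [Nat.factorial_succ]
      push_cast
      rw [Real.log_mul (by positivity) (by positivity)]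
      have h := Real.log_le_sub_one_of_pos (show (0:ℝ) < (m+1)/(m+1+1) by positivity)
      rw [Real.log_div (by positivity) (by positivity)] at h
      have h2 : ((m:ℝ)+1)/(m+1+1) - 1 = -(1/(m+1+1)) := by field_simp; ring
      rw [h2] at h
      have h3 := mul_le_mul_of_nonneg_left h (show (0:ℝ) ≤ m+1+1 by positivity)
      have h4 : ((m:ℝ)+1+1) * -(1/(m+1+1)) = -1 := by field_simp
      rw [h4] at h3
      nlinarith
  rcases Nat.eq_zero_or_pos m with rfl | hm
  · simp
  have hm' : (0:ℝ) < m := by exact_mod_cast hm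
  have h := Real.log_le_sub_one_of_pos (show (0:ℝ) < (m+1)/m by positivity)
  rw [Real.log_div (by positivity) (by positivity)] at h
  have h2 : ((m:ℝ)+1)/m - 1 = 1/m := by field_simp; ring
  rw [h2] at h
  have h3 := mul_le_mul_of_nonneg_left h hm'.le
  rw [mul_one_div_cancel hm'.ne'] at h3
  nlinarith

open Filter Topology in
lemma fact_lim (F : Filter ℕ) (hF : F ≤ atTop) (m : ℕ → ℕ) (μ : ℝ)
    (hm : Tendsto (fun n => (m n : ℝ) / n) F (𝓝 μ)) :
    Tendsto (fun n : ℕ => (1 / (n:ℝ)) * Real.log ((m n).factorial) - (m n : ℝ) / n * Real.log n) F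
      (𝓝 (μ * Real.log μ - μ)) := by
  have hn : Tendsto (fun n : ℕ => (n : ℝ)) F atTop := tendsto_natCast_atTop_atTop.mono_left hF
  have hinv : Tendsto (fun n : ℕ => 1 / (n : ℝ)) F (𝓝 0) := by
    simp only [one_div]
    exact tendsto_inv_atTop_zero.comp hn
  have hmain : Tendsto (fun n => (m n : ℝ) / n * Real.log ((m n : ℝ) / n) - (m n : ℝ) / n) F
      (𝓝 (μ * Real.log μ - μ)) :=
    ((Real.continuous_mul_log.tendsto μ).comp hm).sub hm
  have hpos : ∀ᶠ n : ℕ in F, 0 < (n:ℝ) := hn.eventually_gt_atTop 0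
  have hid : ∀ n : ℕ, 0 < (n:ℝ) → (m n : ℝ) / n * Real.log ((m n : ℝ) / n) =
      1 / (n:ℝ) * (m n * Real.log (m n)) - (m n : ℝ) / n * Real.log n := by
    intro n hn
    rcases Nat.eq_zero_or_pos (m n) with h | h
    · simp [h]
    · have : (0:ℝ) < m n := by exact_mod_cast h
      rw [Real.log_div this.ne' hn.ne']; ring
  -- error
  have herr : Tendsto (fun n : ℕ => 1 / (n:ℝ) * (1 + Real.log (m n + 1))) F (𝓝 0) := by
    have hl : Tendsto (fun n : ℕ => Real.log n / (n:ℝ)) F (𝓝 0) := by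
      have := (Real.isLittleO_log_id_atTop.tendsto_div_nhds_zero).comp hn
      exact this
    have h2 : Tendsto (fun n : ℕ => 1 / (n:ℝ) + (Real.log n / (n:ℝ) + 1 / (n:ℝ) * Real.log (|μ| + 2))) F (𝓝 0) := by
      have := hinv.add (hl.add (hinv.mul_const (Real.log (|μ| + 2))))
      simpa using this
    refine squeeze_zero' (Eventually.of_forall fun n => ?_) ?_ h2
    · have : 0 ≤ Real.log ((m n : ℝ) + 1) := Real.log_nonneg (by linarith [(Nat.cast_nonneg (m n) : (0:ℝ) ≤ m n)])
      positivity
    · have hlt : ∀ᶠ n in F, (m n : ℝ) / n < |μ| + 1 := hm.eventually_lt_const (by linarith [le_abs_self μ])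
      filter_upwards [hlt, hn.eventually_ge_atTop 1] with n h1 h2
      have hn0 : (0:ℝ) < n := by linarith
      have h3 : Real.log (m n + 1) ≤ Real.log n + Real.log (|μ| + 2) := by
        rw [← Real.log_mul (by positivity) (by positivity)]
        apply Real.log_le_log (by positivity)
        rw [div_lt_iff₀ hn0] at h1
        nlinarith
      have := mul_le_mul_of_nonneg_left h3 (show 0 ≤ 1 / (n:ℝ) by positivity)
      have e : Real.log n / (n:ℝ) = 1 / n * Real.log n := by ring
      rw [e]; linarith
  have hup := hmain.add herr
  rw [add_zero] at hup
  refine tendsto_of_tendsto_of_tendsto_of_le_of_le' hmain hup ?_ ?_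
  · filter_upwards [hpos] with n h
    rw [hid n h]
    have := mul_le_mul_of_nonneg_left (fact_lo (m n)) (show 0 ≤ 1 / (n:ℝ) by positivity)
    have e : (m n : ℝ) / n = 1 / n * m n := by ring
    rw [e] at *
    linarith
  · filter_upwards [hpos] with n h
    rw [hid n h]
    have := mul_le_mul_of_nonneg_left (fact_hi (m n)) (show 0 ≤ 1 / (n:ℝ) by positivity)
    have e : (m n : ℝ) / n = 1 / n * m n := by ring
    rw [e] at *
    linarith

open MvPolynomial in
lemma coeff_formula {k : ℕ} {ι σ : Type} [Fintype ι] [DecidableEq ι] [DecidableEq σ] (e : ι → σ →₀ ℕ)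
    (b : Fin k → ι → ℝ) (M : Fin k → ℕ) (E : σ →₀ ℕ) :
    coeff E (∏ t, (∑ i, monomial (e i) (b t i)) ^ M t) =
      ∑ m ∈ Fintype.piFinset (fun t => piAntidiag (univ : Finset ι) (M t)),
        if ∑ t, ∑ i, m t i • e i = E then
          ∏ t, ((Nat.multinomial univ (m t) : ℝ) * ∏ i, b t i ^ m t i) else 0 := by
  have h : ∀ t, (∑ i, monomial (e i) (b t i)) ^ M t = ∑ m ∈ piAntidiag (univ : Finset ι) (M t),
      monomial (∑ i, m i • e i) ((Nat.multinomial univ m : ℝ) * ∏ i, b t i ^ m i) := by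
    intro t
    rw [Finset.sum_pow_eq_sum_piAntidiag]
    refine sum_congr rfl fun m _ => ?_
    simp_rw [monomial_pow]
    rw [← monomial_sum_prod, ← C_mul_monomial]
    simp
  simp_rw [h]
  rw [Finset.prod_univ_sum, coeff_sum]
  refine sum_congr rfl fun m _ => ?_
  rw [← monomial_sum_prod, coeff_monomial]

open MvPolynomial Filter Topology in
theorem gen {k : ℕ} {ι σ : Type} [Fintype ι] [Fintype σ] [DecidableEq ι] [DecidableEq σ]
    (e : ι → σ →₀ ℕ) (b : Fin k → ι → ℝ) (hb : ∀ t i, 0 ≤ b t i)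
    (δ : Fin k → ℝ) (hδ : ∀ t, 0 < δ t) (α x : σ → ℝ) (hx : ∀ s, 0 < x s)
    (Bv : Fin k → ℝ) (hBv : ∀ t, Bv t = ∑ i, b t i * ∏ s, x s ^ e i s) (hBpos : ∀ t, 0 < Bv t)
    (hmean : ∀ s, ∑ t, ∑ i, δ t * (b t i * ∏ s, x s ^ e i s) / Bv t * e i s = α s)
    (F : Filter ℕ) (hF : F ≤ atTop) (M : ℕ → Fin k → ℕ) (E : ℕ → σ →₀ ℕ)
    (hM : ∀ᶠ n in F, ∀ t, (M n t:ℝ) = δ t * n) (hE : ∀ᶠ n in F, ∀ s, (E n s : ℝ) = α s * n)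
    (hc : ∀ᶠ n in F, 0 < coeff (E n) (∏ t, (∑ i, monomial (e i) (b t i)) ^ M n t)) :
    Tendsto (fun n : ℕ => 1 / (n:ℝ) *
      Real.log (coeff (E n) (∏ t, (∑ i, monomial (e i) (b t i)) ^ M n t))) F
      (𝓝 (∑ t, δ t * Real.log (Bv t) - ∑ s, α s * Real.log (x s))) := by
  rcases F.eq_or_neBot with rfl | hne
  · exact tendsto_bot
  have hn : Tendsto (fun n : ℕ => (n : ℝ)) F atTop := tendsto_natCast_atTop_atTop.mono_left hF
  have hinv : Tendsto (fun n : ℕ => 1 / (n : ℝ)) F (𝓝 0) := by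
    simp only [one_div]
    exact tendsto_inv_atTop_zero.comp hn
  have hpos : ∀ᶠ n : ℕ in F, 0 < (n:ℝ) := hn.eventually_gt_atTop 0
  -- weights
  obtain ⟨μ, hμ⟩ : ∃ μ : Fin k → ι → ℝ, ∀ t i, μ t i = δ t * (b t i * ∏ s, x s ^ e i s) / Bv t :=
    ⟨_, fun _ _ => rfl⟩
  simp_rw [← hμ] at hmean
  have hw : ∀ i, 0 < ∏ s, x s ^ e i s := fun i => prod_pos fun s _ => pow_pos (hx s) _
  have hμ0 : ∀ t i, b t i = 0 → μ t i = 0 := by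
    intro t i h; simp [hμ, h]
  have hμpos : ∀ t i, b t i ≠ 0 → 0 < μ t i := by
    intro t i h
    have h1 : 0 < b t i := lt_of_le_of_ne (hb t i) (Ne.symm h)
    have := hδ t; have := hBpos t; have := hw i
    rw [hμ]; positivity
  have hμsum : ∀ t, ∑ i, μ t i = δ t := by
    intro t
    simp_rw [hμ]
    rw [← sum_div, ← mul_sum, ← hBv, mul_div_assoc, div_self (hBpos t).ne', mul_one]
  have hnn : ∀ (M : Fin k → ℕ) (m : Fin k → ι → ℕ),
      0 ≤ ∏ t, ((Nat.multinomial univ (m t) : ℝ) * ∏ i, b t i ^ m t i) := by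
    intro M m
    refine prod_nonneg fun t _ => mul_nonneg (Nat.cast_nonneg _) (prod_nonneg fun i _ => pow_nonneg (hb t i) _)
  have hcnn : ∀ (M : Fin k → ℕ) E, 0 ≤ coeff E (∏ t, (∑ i, monomial (e i) (b t i)) ^ M t) := by
    intro M E
    rw [coeff_formula]
    refine sum_nonneg fun m _ => ?_
    split_ifs
    · exact hnn M m
    · exact le_rfl
  -- existence of near-optimal integer points
  have hex : ∃ C : ℝ, ∀ᶠ n in F, ∃ m : Fin k → ι → ℕ, (∀ t, ∑ i, m t i = M n t) ∧
      ∑ t, ∑ i, m t i • e i = E n ∧ (∀ t i, b t i = 0 → m t i = 0) ∧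
      ∀ t i, |(m t i : ℝ) - n * μ t i| ≤ C := by
    obtain ⟨C, hC⟩ := lat (I := Fin k × ι) (κ := Fin k ⊕ σ ⊕ {j : Fin k × ι // b j.1 j.2 = 0})
      (Sum.elim (fun t j => if j.1 = t then 1 else 0)
        (Sum.elim (fun s j => (e j.2 s : ℤ)) (fun j0 j => if j = j0.1 then 1 else 0)))
    refine ⟨C, ?_⟩
    have hbig : ∀ᶠ n : ℕ in F, ∀ t i, b t i ≠ 0 → C ≤ n * μ t i := by
      rw [eventually_all]; intro t
      rw [eventually_all]; intro i
      by_cases h : b t i = 0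
      · simp [h]
      · have := (hn.atTop_mul_const (hμpos t i h)).eventually_ge_atTop C
        filter_upwards [this] with n h _ using h
    filter_upwards [hbig, hM, hE, hc] with n hbig hM hE hc
    rw [coeff_formula] at hc
    obtain ⟨m0, hm0, hne⟩ := exists_ne_zero_of_sum_ne_zero hc.ne'
    rw [Fintype.mem_piFinset] at hm0
    have hs0 : ∀ t, ∑ i, m0 t i = M n t := fun t => (mem_piAntidiag.1 (hm0 t)).1
    have hE0 : ∑ t, ∑ i, m0 t i • e i = E n := by
      by_contra h; simp [h] at hne
    rw [if_pos hE0] at hne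
    have hz0 : ∀ t i, b t i = 0 → m0 t i = 0 := by
      intro t i h
      by_contra h'
      apply hne
      apply prod_eq_zero (mem_univ t)
      rw [prod_eq_zero (mem_univ i), mul_zero]
      rw [h, zero_pow h']
    have hE0' : ∀ s, ∑ t, ∑ i, m0 t i * e i s = E n s := by
      intro s
      rw [← hE0]
      simp [Finsupp.finsetSum_apply]
    obtain ⟨z, hz, hzC⟩ := hC (fun j => n * μ j.1 j.2 - m0 j.1 j.2) (by
      rintro (t | s | ⟨⟨t, i⟩, h0⟩)
      · simp only [Sum.elim_inl, Int.cast_ite, Int.cast_one, Int.cast_zero, ite_mul, one_mul, zero_mul]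
        rw [Fintype.sum_prod_type]
        rw [sum_eq_single t (by intro t' _ h; simp [h]) (by simp)]
        simp only [if_true, sum_sub_distrib, ← mul_sum, hμsum]
        rw [← Nat.cast_sum, hs0, hM]; ring
      · simp only [Sum.elim_inl, Sum.elim_inr, Int.cast_natCast]
        rw [Fintype.sum_prod_type]
        simp only [mul_sub, sum_sub_distrib]
        have h1 : ∑ t, ∑ i, (e i s : ℝ) * (n * μ t i) = n * α s := by
          rw [← hmean, mul_sum]
          refine sum_congr rfl fun t _ => ?_
          rw [mul_sum]
          refine sum_congr rfl fun i _ => ?_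
          ring
        have h2 : ∑ t, ∑ i, (e i s : ℝ) * (m0 t i) = E n s := by
          rw [← hE0' s]
          push_cast
          refine sum_congr rfl fun t _ => sum_congr rfl fun i _ => ?_
          ring
        rw [h1, h2, hE]; ring
      · simp only [Sum.elim_inr, Int.cast_ite, Int.cast_one, Int.cast_zero, ite_mul, one_mul, zero_mul]
        simp only [sum_ite_eq', mem_univ, if_true]
        simp only at h0
        simp [hμ0 t i h0, hz0 t i h0])
    have hz1 : ∀ t, ∑ i, z (t, i) = 0 := by
      intro t
      have := hz (Sum.inl t)
      simp only [Sum.elim_inl, ite_mul, one_mul, zero_mul] at this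
      rw [Fintype.sum_prod_type, sum_eq_single t (by intro t' _ h; simp [h]) (by simp)] at this
      simpa using this
    have hz2 : ∀ s, ∑ t, ∑ i, z (t, i) * e i s = 0 := by
      intro s
      have := hz (Sum.inr (Sum.inl s))
      simp only [Sum.elim_inl, Sum.elim_inr] at this
      rw [Fintype.sum_prod_type] at this
      rw [← this]
      refine sum_congr rfl fun t _ => sum_congr rfl fun i _ => ?_
      ring
    have hz3 : ∀ t i, b t i = 0 → z (t, i) = 0 := by
      intro t i h
      have := hz (Sum.inr (Sum.inr ⟨(t, i), h⟩))
      simpa using this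
    have hge : ∀ t i, 0 ≤ (m0 t i : ℤ) + z (t, i) := by
      intro t i
      by_cases h : b t i = 0
      · simp [hz3 t i h]
      · have h1 := hbig t i h
        have h2 := (abs_le.1 (hzC (t, i))).2
        simp only at h2
        have : (0:ℝ) ≤ (m0 t i : ℝ) + z (t, i) := by linarith
        exact_mod_cast this
    choose m hm using fun t i => Int.eq_ofNat_of_zero_le (hge t i)
    refine ⟨m, fun t => ?_, ?_, fun t i h => ?_, fun t i => ?_⟩
    · zify
      simp_rw [← hm]
      rw [sum_add_distrib, hz1, add_zero, ← hs0 t]; push_cast; rfl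
    · ext s
      rw [← hE0' s]
      simp only [Finsupp.finsetSum_apply, Finsupp.smul_apply, smul_eq_mul]
      zify
      simp_rw [← hm, add_mul, sum_add_distrib]
      rw [hz2, add_zero]
    · have := hm t i
      rw [hz3 t i h, hz0 t i h] at this
      simpa using this.symm
    · have h1 : (m t i : ℝ) = m0 t i + z (t, i) := by
        have := hm t i
        exact_mod_cast this.symm
      have h2 := hzC (t, i)
      simp only at h2
      rw [h1, abs_sub_comm]
      convert h2 using 2
      ring
  obtain ⟨C, hex⟩ := hex
  obtain ⟨m, hm⟩ := hex.choice
  -- limits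
  have hlim : ∀ t i, Tendsto (fun n => (m n t i : ℝ) / n) F (𝓝 (μ t i)) := by
    intro t i
    rw [tendsto_iff_dist_tendsto_zero]
    have h1 := hinv.mul_const C
    rw [zero_mul] at h1
    refine squeeze_zero' (Eventually.of_forall fun n => dist_nonneg) ?_ h1
    filter_upwards [hm, hpos] with n hm hn
    have h2 := hm.2.2.2 t i
    rw [Real.dist_eq]
    have : (m n t i : ℝ) / n - μ t i = 1 / n * ((m n t i : ℝ) - n * μ t i) := by
      field_simp
    rw [this, abs_mul, abs_of_pos (by positivity : 0 < 1 / (n:ℝ))]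
    gcongr
  have hlimM : ∀ t, Tendsto (fun n => (M n t : ℝ) / n) F (𝓝 (δ t)) := by
    intro t
    refine (tendsto_congr' ?_).2 tendsto_const_nhds
    filter_upwards [hM, hpos] with n hM hn
    rw [hM]; field_simp
  have hT : Tendsto (fun n : ℕ => ∑ t, ((1 / (n:ℝ) * Real.log ((M n t).factorial) -
        (M n t : ℝ) / n * Real.log n)
      - ∑ i, (1 / (n:ℝ) * Real.log ((m n t i).factorial) - (m n t i : ℝ) / n * Real.log n)
      + ∑ i, (m n t i : ℝ) / n * Real.log (b t i))) F
      (𝓝 (∑ t, ((δ t * Real.log (δ t) - δ t) - ∑ i, (μ t i * Real.log (μ t i) - μ t i)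
        + ∑ i, μ t i * Real.log (b t i)))) := by
    refine tendsto_finsetSum _ fun t _ => ?_
    refine ((fact_lim F hF _ _ (hlimM t)).sub (tendsto_finsetSum _ fun i _ =>
      fact_lim F hF (fun n => m n t i) _ (hlim t i))).add (tendsto_finsetSum _ fun i _ =>
      (hlim t i).mul_const _)
  have hval : ∑ t, ((δ t * Real.log (δ t) - δ t) - ∑ i, (μ t i * Real.log (μ t i) - μ t i)
        + ∑ i, μ t i * Real.log (b t i)) =
      ∑ t, δ t * Real.log (Bv t) - ∑ s, α s * Real.log (x s) := by
    have h1 : ∀ t i, μ t i * Real.log (μ t i) = μ t i * Real.log (δ t) + μ t i * Real.log (b t i)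
        + ∑ s, μ t i * e i s * Real.log (x s) - μ t i * Real.log (Bv t) := by
      intro t i
      by_cases h : b t i = 0
      · simp [hμ0 t i h]
      · have : Real.log (μ t i) = Real.log (δ t) + (Real.log (b t i) + ∑ s, e i s * Real.log (x s)) -
            Real.log (Bv t) := by
          rw [hμ, Real.log_div (mul_ne_zero (hδ t).ne' (mul_ne_zero h (hw i).ne')) (hBpos t).ne',
            Real.log_mul (hδ t).ne' (mul_ne_zero h (hw i).ne'), Real.log_mul h (hw i).ne',
            Real.log_prod (fun s _ => (pow_pos (hx s) _).ne')]
          simp_rw [Real.log_pow]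
        rw [this]
        simp_rw [mul_assoc, ← mul_sum]
        ring
    have h2 : ∑ s, α s * Real.log (x s) = ∑ t, ∑ i, ∑ s, μ t i * e i s * Real.log (x s) := by
      simp_rw [← hmean, sum_mul]
      rw [sum_comm]
      refine sum_congr rfl fun t _ => ?_
      rw [sum_comm]
    rw [h2, ← sum_sub_distrib]
    refine sum_congr rfl fun t _ => ?_
    simp_rw [h1]
    simp only [sum_sub_distrib, sum_add_distrib, ← sum_mul, hμsum]
    ring
  rw [hval] at hT
  refine tendsto_of_tendsto_of_tendsto_of_le_of_le' hT tendsto_const_nhds ?_ ?_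
  · filter_upwards [hm, hpos] with n hm hn
    obtain ⟨hm1, hm2, hm3, -⟩ := hm
    have hbm : ∀ t i, 0 < b t i ^ m n t i := by
      intro t i
      by_cases h : b t i = 0
      · simp [hm3 t i h]
      · exact pow_pos (lt_of_le_of_ne (hb t i) (Ne.symm h)) _
    have hmul : ∀ t, (0:ℝ) < Nat.multinomial univ (m n t) := fun t => by
      exact_mod_cast Nat.multinomial_pos _ _
    have hle : ∏ t, ((Nat.multinomial univ (m n t) : ℝ) * ∏ i, b t i ^ m n t i) ≤
        coeff (E n) (∏ t, (∑ i, monomial (e i) (b t i)) ^ M n t) := by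
      rw [coeff_formula]
      have hmem : m n ∈ Fintype.piFinset (fun t => piAntidiag (univ : Finset ι) (M n t)) := by
        rw [Fintype.mem_piFinset]
        intro t
        rw [mem_piAntidiag]
        exact ⟨hm1 t, by simp⟩
      refine le_trans (le_of_eq ?_) (single_le_sum (fun m' _ => ?_) hmem)
      · rw [if_pos hm2]
      · split_ifs
        · exact hnn (M n) m'
        · exact le_rfl
    have hTpos : 0 < ∏ t, ((Nat.multinomial univ (m n t) : ℝ) * ∏ i, b t i ^ m n t i) :=
      prod_pos fun t _ => mul_pos (hmul t) (prod_pos fun i _ => hbm t i)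
    refine le_trans (le_of_eq ?_) (mul_le_mul_of_nonneg_left (Real.log_le_log hTpos hle)
      (by positivity))
    rw [Real.log_prod (fun t _ => (mul_pos (hmul t) (prod_pos fun i _ => hbm t i)).ne'), mul_sum]
    refine sum_congr rfl fun t _ => ?_
    rw [Real.log_mul (hmul t).ne' (prod_pos fun i _ => hbm t i).ne',
      Real.log_prod (fun i _ => (hbm t i).ne')]
    have hspec : Real.log ((M n t).factorial) = ∑ i, Real.log ((m n t i).factorial) +
        Real.log (Nat.multinomial univ (m n t)) := by
      have := Nat.multinomial_spec univ (m n t)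
      rw [hm1 t] at this
      rw [← this]
      push_cast
      rw [Real.log_mul (prod_pos fun i _ => by positivity).ne' (hmul t).ne',
        Real.log_prod (fun i _ => by positivity)]
    have hsum : (M n t : ℝ) = ∑ i, (m n t i : ℝ) := by
      rw [← hm1 t]; push_cast; rfl
    rw [hspec, sum_sub_distrib, hsum]
    simp_rw [Real.log_pow, sum_div, sum_mul, mul_add, mul_sum]
    have : ∀ i, 1 / (n:ℝ) * (m n t i * Real.log (b t i)) = (m n t i : ℝ) / n * Real.log (b t i) :=
      fun i => by ring
    simp_rw [this]
    ring
  · filter_upwards [hM, hE, hc, hpos] with n hM hE hc hn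
    set P := ∏ t, (∑ i, monomial (e i) (b t i)) ^ M n t with hP
    have hev : eval x P = ∏ t, Bv t ^ M n t := by
      rw [hP, map_prod]
      refine prod_congr rfl fun t _ => ?_
      rw [map_pow, map_sum, hBv]
      congr 1
      refine sum_congr rfl fun i _ => ?_
      rw [eval_monomial, Finsupp.prod_fintype _ _ (by simp)]
    have hle : coeff (E n) P * ∏ s, x s ^ E n s ≤ ∏ t, Bv t ^ M n t := by
      rw [← hev, eval_eq']
      exact single_le_sum (f := fun d => coeff d P * ∏ s, x s ^ d s)
        (fun d _ => mul_nonneg (hcnn _ d) (prod_nonneg fun s _ => pow_nonneg (hx s).le _))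
        (mem_support_iff.2 hc.ne')
    have hxp : 0 < ∏ s, x s ^ E n s := prod_pos fun s _ => pow_pos (hx s) _
    have hlog := Real.log_le_log (mul_pos hc hxp) hle
    rw [Real.log_mul hc.ne' hxp.ne', Real.log_prod (fun s _ => (pow_pos (hx s) _).ne'),
      Real.log_prod (fun t _ => (pow_pos (hBpos t) _).ne')] at hlog
    simp_rw [Real.log_pow, hM, hE] at hlog
    have e1 : ∑ t, δ t * n * Real.log (Bv t) = n * ∑ t, δ t * Real.log (Bv t) := by
      rw [mul_sum]; exact sum_congr rfl fun t _ => by ring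
    have e2 : ∑ s, α s * n * Real.log (x s) = n * ∑ s, α s * Real.log (x s) := by
      rw [mul_sum]; exact sum_congr rfl fun t _ => by ring
    rw [e1, e2] at hlog
    rw [one_div, inv_mul_le_iff₀ hn]
    linarith
end Aux

open MvPolynomial in
lemma polyB_eq (k p q : ℕ) (B : ℕ → ℕ → ℝ) (T : Finset (ℕ × ℕ))
    (hT : Finset.Icc 1 k ×ˢ Finset.Icc p q ⊆ T) :
    polyB k p q B = ∑ i : Option T, monomial
      (i.elim 0 fun w => Finsupp.single (0 : Fin 2) w.1.1 + Finsupp.single (1 : Fin 2) w.1.2)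
      (i.elim (1:ℝ) fun w => if w.1 ∈ Finset.Icc 1 k ×ˢ Finset.Icc p q then B w.1.1 w.1.2 else 0) := by
  rw [Fintype.sum_option, polyB]
  simp only [Option.elim]
  congr 1
  rw [Finset.sum_coe_sort T (fun w => monomial
    (Finsupp.single (0 : Fin 2) w.1 + Finsupp.single (1 : Fin 2) w.2)
    (if w ∈ Finset.Icc 1 k ×ˢ Finset.Icc p q then B w.1 w.2 else 0))]
  rw [← Finset.sum_subset hT (by intro w _ h; simp only [if_neg h, map_zero]), Finset.sum_product]
  refine Finset.sum_congr rfl fun u hu => Finset.sum_congr rfl fun v hv => ?_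
  rw [if_pos (Finset.mk_mem_product hu hv), X_pow_eq_monomial, X_pow_eq_monomial, C_mul_monomial,
    monomial_mul]
  simp

open MvPolynomial in
lemma eval_pderiv_aux {ι : Type} [Fintype ι] (e : ι → Fin 2 →₀ ℕ) (b : ι → ℝ) (x : Fin 2 → ℝ)
    (s : Fin 2) : x s * eval x (pderiv s (∑ i, monomial (e i) (b i))) =
      ∑ i, b i * (∏ s, x s ^ e i s) * e i s := by
  have h : X s * pderiv s (∑ i, monomial (e i) (b i)) = ∑ i, (e i s) • monomial (e i) (b i) := by
    rw [map_sum, Finset.mul_sum]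
    refine Finset.sum_congr rfl fun i _ => ?_
    rw [X_mul_pderiv_monomial]
  have h2 := congrArg (eval x) h
  rw [map_mul, eval_X] at h2
  rw [h2, map_sum]
  refine Finset.sum_congr rfl fun i _ => ?_
  rw [map_nsmul, eval_monomial, Finsupp.prod_fintype _ _ (by simp), nsmul_eq_mul]
  ring

lemma num_cast (a : ℚ) (ha : 0 < a) (n : ℕ) (h : (a * (n:ℚ)).den = 1) :
    (((a * (n:ℚ)).num.toNat : ℕ) : ℝ) = (a : ℝ) * n := by
  have h0 : 0 ≤ (a * (n:ℚ)).num := Rat.num_nonneg.2 (by positivity)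
  have h1 : (((a * (n:ℚ)).num.toNat : ℕ) : ℤ) = (a * (n:ℚ)).num := Int.toNat_of_nonneg h0
  have h2 : (((a * (n:ℚ)).num : ℤ) : ℚ) = a * n := Rat.coe_int_num_of_den_eq_one h
  rw [← h1] at h2
  exact_mod_cast congrArg (fun r : ℚ => (r : ℝ)) h2

/-- Exponential growth rate of
`Coeff[∏_t (B_t(x,y))^{δ_t n}, x^{α n} y^{β n}]`: it converges to
`∑_t δ_t log B_t(x₀,y₀) - α log x₀ - β log y₀`, where `(x₀,y₀)` solves the
pair of saddle-point equations. -/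
theorem stmt5 (k : ℕ) (hk : 1 ≤ k)
    (kk p q : Fin k → ℕ)
    (hkk : ∀ t, 1 ≤ kk t) (hp : ∀ t, 1 ≤ p t) (hpq : ∀ t, p t ≤ q t)
    (B : Fin k → ℕ → ℕ → ℝ)
    (hB : ∀ t u v, 1 ≤ u → u ≤ kk t → p t ≤ v → v ≤ q t → 0 ≤ B t u v)
    (δ : Fin k → ℚ) (hδ : ∀ t, 0 < δ t)
    (α β : ℚ) (hα : 0 < α) (hβ : 0 < β)
    (x₀ y₀ : ℝ) (hx₀ : 0 < x₀) (hy₀ : 0 < y₀)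
    (heqx : x₀ * ∑ t, (δ t : ℝ) *
        (MvPolynomial.eval ![x₀, y₀]
            (MvPolynomial.pderiv (0 : Fin 2) (polyB (kk t) (p t) (q t) (B t)))
          / MvPolynomial.eval ![x₀, y₀] (polyB (kk t) (p t) (q t) (B t))) = (α : ℝ))
    (heqy : y₀ * ∑ t, (δ t : ℝ) *
        (MvPolynomial.eval ![x₀, y₀]
            (MvPolynomial.pderiv (1 : Fin 2) (polyB (kk t) (p t) (q t) (B t)))
          / MvPolynomial.eval ![x₀, y₀] (polyB (kk t) (p t) (q t) (B t))) = (β : ℝ)) :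
    Filter.Tendsto
      (fun n : ℕ => (1 / (n : ℝ)) *
        Real.log (MvPolynomial.coeff
          (Finsupp.single (0 : Fin 2) ((α * (n : ℚ)).num.toNat) +
            Finsupp.single (1 : Fin 2) ((β * (n : ℚ)).num.toNat))
          (∏ t, (polyB (kk t) (p t) (q t) (B t)) ^ ((δ t * (n : ℚ)).num.toNat))))
      (Filter.atTop ⊓ Filter.principal
        {n : ℕ | 0 < n ∧ (∀ t, (δ t * (n : ℚ)).den = 1) ∧
          (α * (n : ℚ)).den = 1 ∧ (β * (n : ℚ)).den = 1 ∧
          0 < MvPolynomial.coeff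
            (Finsupp.single (0 : Fin 2) ((α * (n : ℚ)).num.toNat) +
              Finsupp.single (1 : Fin 2) ((β * (n : ℚ)).num.toNat))
            (∏ t, (polyB (kk t) (p t) (q t) (B t)) ^ ((δ t * (n : ℚ)).num.toNat))})
      (nhds (∑ t, (δ t : ℝ) *
          Real.log (MvPolynomial.eval ![x₀, y₀] (polyB (kk t) (p t) (q t) (B t)))
        - (α : ℝ) * Real.log x₀ - (β : ℝ) * Real.log y₀)) := by
  classical
  let T : Finset (ℕ × ℕ) := Finset.univ.biUnion fun t => Finset.Icc 1 (kk t) ×ˢ Finset.Icc (p t) (q t)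
  have hT : ∀ t, Finset.Icc 1 (kk t) ×ˢ Finset.Icc (p t) (q t) ⊆ T := fun t =>
    Finset.subset_biUnion_of_mem (fun t => Finset.Icc 1 (kk t) ×ˢ Finset.Icc (p t) (q t))
      (Finset.mem_univ t)
  let e : Option T → Fin 2 →₀ ℕ := fun i =>
    i.elim 0 fun w => Finsupp.single (0 : Fin 2) w.1.1 + Finsupp.single (1 : Fin 2) w.1.2
  let b : Fin k → Option T → ℝ := fun t i => i.elim (1:ℝ) fun w =>
    if w.1 ∈ Finset.Icc 1 (kk t) ×ˢ Finset.Icc (p t) (q t) then B t w.1.1 w.1.2 else 0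
  have hP : ∀ t, polyB (kk t) (p t) (q t) (B t) = ∑ i, MvPolynomial.monomial (e i) (b t i) :=
    fun t => polyB_eq _ _ _ _ T (hT t)
  have hb : ∀ t i, 0 ≤ b t i := by
    rintro t (_ | w)
    · exact zero_le_one
    · simp only [b, Option.elim]
      split_ifs with h
      · rw [Finset.mem_product, Finset.mem_Icc, Finset.mem_Icc] at h
        exact hB t _ _ h.1.1 h.1.2 h.2.1 h.2.2
      · exact le_rfl
  have hx : ∀ s, 0 < (![x₀, y₀] : Fin 2 → ℝ) s := by
    intro s; fin_cases s
    · exact hx₀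
    · exact hy₀
  have hev : ∀ t, MvPolynomial.eval ![x₀, y₀] (∑ i, MvPolynomial.monomial (e i) (b t i)) =
      ∑ i, b t i * ∏ s, (![x₀, y₀] : Fin 2 → ℝ) s ^ e i s := by
    intro t
    rw [map_sum]
    refine Finset.sum_congr rfl fun i _ => ?_
    rw [MvPolynomial.eval_monomial, Finsupp.prod_fintype _ _ (by simp)]
  have hpos : ∀ t, 0 < MvPolynomial.eval ![x₀, y₀] (∑ i, MvPolynomial.monomial (e i) (b t i)) := by
    intro t
    rw [hev, Fintype.sum_option]
    refine add_pos_of_pos_of_nonneg ?_ (Finset.sum_nonneg fun i _ => mul_nonneg (hb t _)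
      (Finset.prod_nonneg fun s _ => pow_nonneg (hx s).le _))
    simp [b, e]
  simp_rw [hP] at heqx heqy ⊢
  have hmean : ∀ (s : Fin 2) (a : ℝ), (![x₀, y₀] : Fin 2 → ℝ) s * ∑ t, (δ t : ℝ) *
        (MvPolynomial.eval ![x₀, y₀]
            (MvPolynomial.pderiv s (∑ i, MvPolynomial.monomial (e i) (b t i)))
          / MvPolynomial.eval ![x₀, y₀] (∑ i, MvPolynomial.monomial (e i) (b t i))) = a →
      ∑ t, ∑ i, (δ t : ℝ) * (b t i * ∏ s, (![x₀, y₀] : Fin 2 → ℝ) s ^ e i s) /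
        MvPolynomial.eval ![x₀, y₀] (∑ i, MvPolynomial.monomial (e i) (b t i)) * e i s = a := by
    intro s a h
    rw [← h, Finset.mul_sum]
    refine Finset.sum_congr rfl fun t _ => ?_
    have h1 := eval_pderiv_aux e (b t) ![x₀, y₀] s
    rw [mul_left_comm, ← mul_div_assoc, h1, Finset.sum_div, Finset.mul_sum]
    refine Finset.sum_congr rfl fun i _ => ?_
    ring
  let S : Set ℕ := {n : ℕ | 0 < n ∧ (∀ t, (δ t * (n : ℚ)).den = 1) ∧
          (α * (n : ℚ)).den = 1 ∧ (β * (n : ℚ)).den = 1 ∧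
          0 < MvPolynomial.coeff
            (Finsupp.single (0 : Fin 2) ((α * (n : ℚ)).num.toNat) +
              Finsupp.single (1 : Fin 2) ((β * (n : ℚ)).num.toNat))
            (∏ t, (∑ i, MvPolynomial.monomial (e i) (b t i)) ^ ((δ t * (n : ℚ)).num.toNat))}
  have hmem : ∀ᶠ n in (Filter.atTop ⊓ Filter.principal S : Filter ℕ), n ∈ S :=
    Filter.mem_inf_of_right (Filter.mem_principal_self S)
  have main := gen e b hb (fun t => (δ t : ℝ)) (fun t => by exact_mod_cast hδ t)
    ![(α:ℝ), (β:ℝ)] ![x₀, y₀] hx _ hev hpos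
    (by
      intro s; fin_cases s
      · exact hmean 0 _ heqx
      · exact hmean 1 _ heqy)
    (Filter.atTop ⊓ Filter.principal S) inf_le_left (fun n t => (δ t * (n : ℚ)).num.toNat)
    (fun n => Finsupp.single (0 : Fin 2) ((α * (n : ℚ)).num.toNat) +
            Finsupp.single (1 : Fin 2) ((β * (n : ℚ)).num.toNat))
    (hmem.mono fun n hn t => num_cast _ (hδ t) n (hn.2.1 t))
    (hmem.mono fun n hn s => by
      fin_cases s
      · simpa using num_cast _ hα n hn.2.2.1
      · simpa using num_cast _ hβ n hn.2.2.2.1)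
    (hmem.mono fun n hn => hn.2.2.2.2)
  simpa only [Fin.sum_univ_two, Matrix.cons_val_zero, Matrix.cons_val_one, sub_sub] using main
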